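/- Let β ∈ (0,2], μ ∈ (1/2,1], T ∈ (0,∞) and s ≥ −1. There exists a constant c = c(β,μ,s,T) > 0 such that for every measurable function G : ℝⁿ × ℝⁿ → ℂ with ∫_{ℝ^{2n}} ω_β(k,ξ)^{2(s+1/2−(1−μ))} |G(k,ξ)|² dk dξ < ∞, the function U(t,k,ξ) = G(k,ξ+tk) e_β(t,k,ξ) satisfies ∫₀ᵀ ∫_{ℝ^{2n}} t^{2−2μ} ω_β(k,ξ)^{2(s+1)} |U(t,k,ξ)|² dk dξ dt ≤ c ∫_{ℝ^{2n}} ω_β(k,ξ)^{2(s+1/2−(1−μ))} |G(k,ξ)|² dk dξ. -/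

import Mathlib

open MeasureTheory Set Filter
open scoped ENNReal

noncomputable section

/-- `ℝⁿ` with the Euclidean norm. -/
abbrev En (n : ℕ) : Type := EuclideanSpace ℝ (Fin n)

/-- `e_β(t,k,ξ) = exp(−∫₀ᵗ ‖ξ + σ k‖^β dσ)`. -/
def eB (n : ℕ) (β t : ℝ) (k ξ : En n) : ℝ :=
  Real.exp (-(∫ σ in (0:ℝ)..t, ‖ξ + σ • k‖ ^ β))

/-- `ω_β(k,ξ) = 1 + ‖k‖^{β/(β+1)} + ‖ξ‖^β`. -/
def omegaB (n : ℕ) (β : ℝ) (k ξ : En n) : ℝ := 1 + ‖k‖ ^ (β / (β + 1)) + ‖ξ‖ ^ β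

lemma const_mul_le_integral {f : ℝ → ℝ} (hf : Continuous f) (h0 : ∀ x, 0 ≤ f x)
    {t u v m : ℝ} (hu : 0 ≤ u) (huv : u ≤ v) (hv : v ≤ t) (hm : ∀ x ∈ Icc u v, m ≤ f x) :
    (v - u) * m ≤ ∫ σ in (0:ℝ)..t, f σ := by
  calc (v - u) * m = ∫ _ in u..v, m := by simp
    _ ≤ ∫ σ in u..v, f σ :=
      intervalIntegral.integral_mono_on huv (by simp) (hf.intervalIntegrable _ _) hm
    _ ≤ ∫ σ in (0:ℝ)..t, f σ :=
      intervalIntegral.integral_mono_interval hu huv hv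
        (Eventually.of_forall h0) (hf.intervalIntegrable _ _)

lemma max_rpow_le_integral_norm_rpow {E : Type*} [NormedAddCommGroup E] [NormedSpace ℝ E]
    {β t : ℝ} (hβ : β ∈ Ioc (0:ℝ) 2) (ht : 0 ≤ t) (k η : E) :
    t * max ‖η‖ (t * ‖k‖) ^ β ≤ 64 * ∫ σ in (0:ℝ)..t, ‖η - t • k + σ • k‖ ^ β := by
  set M := max ‖η‖ (t * ‖k‖) with hM
  have hM0 : 0 ≤ M := (norm_nonneg η).trans (le_max_left _ _)
  have hcont : Continuous fun σ : ℝ => ‖η - t • k + σ • k‖ ^ β :=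
    Continuous.rpow_const (by fun_prop) fun _ => Or.inr hβ.1.le
  have hnn : ∀ σ : ℝ, 0 ≤ ‖η - t • k + σ • k‖ ^ β := fun σ => by positivity
  have key : (t / 4) * (M / 4) ^ β ≤ ∫ σ in (0:ℝ)..t, ‖η - t • k + σ • k‖ ^ β := by
    have hk := norm_nonneg k
    have hsub : ∀ σ : ℝ, η - t • k + σ • k = η - (t - σ) • k := fun σ => by
      rw [sub_smul]; abel
    rcases le_total (t * ‖k‖ / 2) ‖η‖ with h | h
    · have := const_mul_le_integral hcont hnn (t := t) (u := 3 * t / 4) (v := t)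
        (m := (M / 4) ^ β) (by linarith) (by linarith) le_rfl ?_
      · convert this using 2; ring
      · intro σ hσ
        refine Real.rpow_le_rpow (by positivity) ?_ hβ.1.le
        rw [hsub]
        have h1 := norm_sub_norm_le η ((t - σ) • k)
        rw [norm_smul, Real.norm_of_nonneg (by linarith [hσ.2])] at h1
        have h2 : (t - σ) * ‖k‖ ≤ t / 4 * ‖k‖ :=
          mul_le_mul_of_nonneg_right (by linarith [hσ.1]) hk
        have h3 : M ≤ 2 * ‖η‖ := max_le (by linarith [norm_nonneg η]) (by linarith)
        linarith
    · have := const_mul_le_integral hcont hnn (t := t) (u := 0) (v := t / 4)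
        (m := (M / 4) ^ β) le_rfl (by linarith) (by linarith) ?_
      · convert this using 2; ring
      · intro σ hσ
        refine Real.rpow_le_rpow (by positivity) ?_ hβ.1.le
        rw [hsub]
        have h1 := norm_sub_norm_le ((t - σ) • k) η
        rw [norm_smul, Real.norm_of_nonneg (by linarith [hσ.2]), norm_sub_rev] at h1
        have h2 : 3 * t / 4 * ‖k‖ ≤ (t - σ) * ‖k‖ :=
          mul_le_mul_of_nonneg_right (by linarith [hσ.2]) hk
        have h3 : M ≤ t * ‖k‖ := max_le (by nlinarith [norm_nonneg η]) le_rfl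
        linarith
  have h4 : (4:ℝ) ^ β ≤ 16 := by
    calc (4:ℝ) ^ β ≤ 4 ^ (2:ℝ) := Real.rpow_le_rpow_of_exponent_le (by norm_num) hβ.2
      _ = 16 := by norm_num
  have h5 : M ^ β ≤ 16 * (M / 4) ^ β := by
    calc M ^ β = 4 ^ β * (M / 4) ^ β := by
          rw [← Real.mul_rpow (by norm_num) (by positivity)]; congr 1; ring
      _ ≤ _ := by gcongr
  nlinarith [mul_le_mul_of_nonneg_left h5 ht]

lemma one_le_omegaB (n : ℕ) (β : ℝ) (k ξ : En n) : 1 ≤ omegaB n β k ξ := by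
  unfold omegaB
  have h1 : 0 ≤ ‖k‖ ^ (β / (β + 1)) := by positivity
  have h2 : 0 ≤ ‖ξ‖ ^ β := by positivity
  linarith

lemma rpow_div_rpow_add_one {β x : ℝ} (hβ : 0 < β) (hx : 0 ≤ x) :
    (x ^ (β / (β + 1))) ^ (β + 1) = x ^ β := by
  rw [← Real.rpow_mul hx, div_mul_cancel₀ _ (by positivity)]

lemma mul_omegaB_le {n : ℕ} {β t T : ℝ} (hβ : β ∈ Ioc (0:ℝ) 2) (ht : t ∈ Ioo 0 T)
    (k η : En n) :
    t * omegaB n β k η ≤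
      T + 1 + 128 * ∫ σ in (0:ℝ)..t, ‖η - t • k + σ • k‖ ^ β := by
  have ht0 : 0 < t := ht.1
  have hmax := max_rpow_le_integral_norm_rpow hβ ht0.le k η
  set Φ := ∫ σ in (0:ℝ)..t, ‖η - t • k + σ • k‖ ^ β
  have h1 : t * ‖η‖ ^ β ≤ 64 * Φ := le_trans (by
    gcongr
    · exact hβ.1.le
    · exact le_max_left _ _) hmax
  have h2 : t * (t * ‖k‖) ^ β ≤ 64 * Φ := le_trans (by
    gcongr
    · exact hβ.1.le
    · exact le_max_right _ _) hmax
  set K := ‖k‖ ^ (β / (β + 1)) with hK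
  have hK0 : 0 ≤ K := by positivity
  have h3 : t * (t * ‖k‖) ^ β = (t * K) ^ (β + 1) := by
    rw [Real.mul_rpow ht0.le (norm_nonneg _), Real.mul_rpow ht0.le hK0,
      rpow_div_rpow_add_one hβ.1 (norm_nonneg _), Real.rpow_add_one ht0.ne']
    ring
  have h4 : t * K ≤ 1 + (t * K) ^ (β + 1) := by
    rcases le_total (t * K) 1 with h | h
    · have : 0 ≤ (t * K) ^ (β + 1) := by positivity
      linarith
    · have := Real.self_le_rpow_of_one_le h (by linarith [hβ.1] : 1 ≤ β + 1)
      linarith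
  have h5 : t * omegaB n β k η = t + t * K + t * ‖η‖ ^ β := by unfold omegaB; ring
  linarith [ht.2]

lemma omegaB_sub_smul_le {n : ℕ} {β t : ℝ} (hβ : β ∈ Ioc (0:ℝ) 2) (ht : 0 ≤ t)
    (k η : En n) :
    omegaB n β k (η - t • k) ≤
      8 * omegaB n β k η * (1 + t * omegaB n β k η) ^ (2:ℝ) := by
  have hW := one_le_omegaB n β k η
  set W := omegaB n β k η with hWd
  set K := ‖k‖ ^ (β / (β + 1)) with hK
  have hK0 : 0 ≤ K := by positivity
  have hη0 : 0 ≤ ‖η‖ ^ β := by positivity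
  have hWeq : W = 1 + K + ‖η‖ ^ β := rfl
  have hX : 1 ≤ 1 + t * W := by nlinarith
  have hnorm : ‖η - t • k‖ ≤ ‖η‖ + t * ‖k‖ := by
    have := norm_sub_le η (t • k)
    rwa [norm_smul, Real.norm_of_nonneg ht] at this
  have h2 : (2:ℝ) ^ β ≤ 4 := by
    calc (2:ℝ) ^ β ≤ 2 ^ (2:ℝ) := Real.rpow_le_rpow_of_exponent_le (by norm_num) hβ.2
      _ = 4 := by norm_num
  have htk : (t * ‖k‖) ^ β ≤ W * (1 + t * W) ^ (2:ℝ) := by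
    calc (t * ‖k‖) ^ β = K * (t * K) ^ β := by
          rw [Real.mul_rpow ht (norm_nonneg _), Real.mul_rpow ht hK0,
            ← rpow_div_rpow_add_one hβ.1 (norm_nonneg k),
            Real.rpow_add_one' hK0 (by linarith [hβ.1])]
          ring
      _ ≤ W * (1 + t * W) ^ β := by
          have : t * K ≤ t * W := mul_le_mul_of_nonneg_left (by linarith) ht
          gcongr
          · linarith
          · exact hβ.1.le
          · linarith
      _ ≤ W * (1 + t * W) ^ (2:ℝ) := by
          gcongr
          exact hβ.2
  have hsum : ‖η - t • k‖ ^ β ≤ 4 * (‖η‖ ^ β + (t * ‖k‖) ^ β) := by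
    have htk0 : 0 ≤ (t * ‖k‖) ^ β := by positivity
    have haux : ∀ m : ℝ, 0 ≤ m → ‖η‖ + t * ‖k‖ ≤ 2 * m → ‖η - t • k‖ ^ β ≤ 4 * m ^ β := by
      intro m hm h
      calc ‖η - t • k‖ ^ β ≤ (2 * m) ^ β :=
            Real.rpow_le_rpow (norm_nonneg _) (hnorm.trans h) hβ.1.le
        _ = 2 ^ β * m ^ β := Real.mul_rpow (by norm_num) hm
        _ ≤ 4 * m ^ β := by gcongr
    rcases le_total ‖η‖ (t * ‖k‖) with h | h
    · have := haux _ (by positivity) (by linarith : ‖η‖ + t * ‖k‖ ≤ 2 * (t * ‖k‖))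
      linarith
    · have := haux _ (by positivity) (by linarith : ‖η‖ + t * ‖k‖ ≤ 2 * ‖η‖)
      linarith
  have hX2 : 1 ≤ (1 + t * W) ^ (2:ℝ) := Real.one_le_rpow hX (by norm_num)
  have hWX : W ≤ W * (1 + t * W) ^ (2:ℝ) := le_mul_of_one_le_right (by linarith) hX2
  calc omegaB n β k (η - t • k) = 1 + K + ‖η - t • k‖ ^ β := rfl
    _ ≤ 4 * W + 4 * (t * ‖k‖) ^ β := by linarith
    _ ≤ _ := by linarith

lemma one_add_rpow_le_exp {p δ x : ℝ} (hp : 0 ≤ p) (hδ : 0 < δ) (hx : 0 ≤ x) :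
    (1 + x) ^ p ≤ ((p + 1) / δ) ^ p * Real.exp δ * Real.exp (δ * x) := by
  have hε : 0 < δ / (p + 1) := by positivity
  have h1 : 1 + x ≤ (p + 1) / δ * Real.exp (δ / (p + 1) * (1 + x)) := by
    calc 1 + x = (p + 1) / δ * (δ / (p + 1) * (1 + x)) := by field_simp
      _ ≤ _ := by
        gcongr
        linarith [Real.add_one_le_exp (δ / (p + 1) * (1 + x))]
  calc (1 + x) ^ p ≤ ((p + 1) / δ * Real.exp (δ / (p + 1) * (1 + x))) ^ p := by gcongr
    _ = ((p + 1) / δ) ^ p * Real.exp (δ / (p + 1) * (1 + x) * p) := by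
      rw [Real.mul_rpow (by positivity) (by positivity), ← Real.exp_mul]
    _ ≤ ((p + 1) / δ) ^ p * Real.exp (δ + δ * x) := by
      gcongr
      rw [show δ / (p + 1) * (1 + x) * p = (δ + δ * x) * (p / (p + 1)) by ring]
      exact mul_le_of_le_one_right (by positivity) ((div_le_one (by positivity)).2 (by linarith))
    _ = _ := by rw [Real.exp_add]; ring

lemma exists_omegaB_rpow_mul_eB_sq_le {β a T : ℝ} (n : ℕ) (hβ : β ∈ Ioc (0:ℝ) 2)
    (ha : 0 ≤ a) :
    ∃ C : ℝ, 0 < C ∧ ∀ t ∈ Ioo 0 T, ∀ k η : En n,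
      omegaB n β k (η - t • k) ^ a * eB n β t k (η - t • k) ^ 2 ≤
        C * omegaB n β k η ^ a * Real.exp (-(omegaB n β k η / 128 * t)) := by
  refine ⟨8 ^ a * (((2 * a + 1) / (1 / 128)) ^ (2 * a) * Real.exp (1 / 128)) *
    Real.exp ((T + 1) / 64), by positivity, fun t ht k η => ?_⟩
  have ht0 : 0 < t := ht.1
  have hW := one_le_omegaB n β k η
  have hW' := one_le_omegaB n β k (η - t • k)
  have hlow := mul_omegaB_le hβ ht k η
  have hup := omegaB_sub_smul_le hβ ht0.le k η
  have hx : 0 ≤ t * omegaB n β k η := by positivity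
  have hexp := one_add_rpow_le_exp (p := 2 * a) (δ := 1 / 128) (by positivity) (by norm_num) hx
  unfold eB
  set W := omegaB n β k η
  set Φ := ∫ σ in (0:ℝ)..t, ‖η - t • k + σ • k‖ ^ β
  set D := ((2 * a + 1) / (1 / 128)) ^ (2 * a) * Real.exp (1 / 128)
  have h1 : omegaB n β k (η - t • k) ^ a ≤ 8 ^ a * W ^ a * (D * Real.exp (1 / 128 * (t * W))) := by
    calc omegaB n β k (η - t • k) ^ a ≤ (8 * W * (1 + t * W) ^ (2:ℝ)) ^ a := by gcongr
      _ = 8 ^ a * W ^ a * (1 + t * W) ^ (2 * a) := by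
        rw [Real.mul_rpow (by positivity) (by positivity), Real.mul_rpow (by positivity)
          (by positivity), ← Real.rpow_mul (by positivity)]
      _ ≤ _ := by gcongr
  have h2 : Real.exp (-Φ) ^ 2 ≤ Real.exp ((T + 1) / 64) * Real.exp (-(t * W / 64)) := by
    rw [← Real.exp_nat_mul, ← Real.exp_add]
    gcongr
    push_cast
    linarith
  calc _ ≤ 8 ^ a * W ^ a * (D * Real.exp (1 / 128 * (t * W))) *
        (Real.exp ((T + 1) / 64) * Real.exp (-(t * W / 64))) := by gcongr
    _ = 8 ^ a * D * Real.exp ((T + 1) / 64) * W ^ a *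
        (Real.exp (1 / 128 * (t * W)) * Real.exp (-(t * W / 64))) := by ring
    _ = _ := by rw [← Real.exp_add]; congr 2; ring

lemma lintegral_rpow_mul_exp_neg_mul_le {b r : ℝ} (T : ℝ) (hb : 0 ≤ b) (hr : 0 < r) :
    ∫⁻ t in Ioo (0:ℝ) T, ENNReal.ofReal (t ^ b * Real.exp (-(r * t))) ≤
      ENNReal.ofReal ((1 / r) ^ (b + 1) * Real.Gamma (b + 1)) := by
  have hint := Real.integral_rpow_mul_exp_neg_mul_Ioi (a := b + 1) (by positivity) hr
  simp only [add_sub_cancel_right] at hint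
  have hpos : 0 < (1 / r) ^ (b + 1) * Real.Gamma (b + 1) :=
    mul_pos (by positivity) (Real.Gamma_pos_of_pos (by positivity))
  have hI : IntegrableOn (fun t : ℝ => t ^ b * Real.exp (-(r * t))) (Ioi 0) := by
    by_contra h
    rw [integral_undef h] at hint
    exact hpos.ne hint
  calc _ ≤ ∫⁻ t in Ioi (0:ℝ), ENNReal.ofReal (t ^ b * Real.exp (-(r * t))) :=
        lintegral_mono_set Ioo_subset_Ioi_self
    _ = _ := by
      rw [← ofReal_integral_eq_lintegral_ofReal hI, hint]
      filter_upwards [ae_restrict_mem measurableSet_Ioi] with t ht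
      have : (0:ℝ) < t := ht
      positivity

lemma measurable_omegaB (n : ℕ) (β : ℝ) :
    Measurable fun p : En n × En n => omegaB n β p.1 p.2 := by
  unfold omegaB
  fun_prop

theorem stmt5 (n : ℕ) (hn : 1 ≤ n) (β μ T s : ℝ) (hβ : β ∈ Ioc (0:ℝ) 2)
    (hμ : μ ∈ Ioc (1/2 : ℝ) 1) (hT : 0 < T) (hs : (-1:ℝ) ≤ s) :
    ∃ c : ℝ, 0 < c ∧ ∀ G : En n → En n → ℂ,
      Measurable (fun p : En n × En n => G p.1 p.2) →
      (∫⁻ (k : En n), ∫⁻ (ξ : En n),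
          ENNReal.ofReal (omegaB n β k ξ ^ (2 * (s + 1/2 - (1 - μ))) * ‖G k ξ‖ ^ 2)) < ⊤ →
      (∫⁻ t in Ioo (0:ℝ) T, ∫⁻ (k : En n), ∫⁻ (ξ : En n),
          ENNReal.ofReal (t ^ (2 - 2*μ) * omegaB n β k ξ ^ (2 * (s + 1)) *
            ‖G k (ξ + t • k) * (eB n β t k ξ : ℂ)‖ ^ 2))
        ≤ ENNReal.ofReal c *
          ∫⁻ (k : En n), ∫⁻ (ξ : En n),
            ENNReal.ofReal (omegaB n β k ξ ^ (2 * (s + 1/2 - (1 - μ))) * ‖G k ξ‖ ^ 2) := by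
  set a := 2 * (s + 1) with ha
  set b := 2 - 2 * μ with hb
  have ha0 : 0 ≤ a := by linarith
  have hb0 : 0 ≤ b := by linarith [hμ.2]
  have hexp : 2 * (s + 1/2 - (1 - μ)) = a - (b + 1) := by rw [ha, hb]; ring
  rw [hexp]
  obtain ⟨C, hC, hbound⟩ := exists_omegaB_rpow_mul_eB_sq_le (T := T) n hβ ha0
  have hΓ : 0 < Real.Gamma (b + 1) := Real.Gamma_pos_of_pos (by positivity)
  refine ⟨C * (128 ^ (b + 1) * Real.Gamma (b + 1)), by positivity, fun G hG _ => ?_⟩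
  have hmeas : Measurable fun q : ℝ × En n × En n =>
      ENNReal.ofReal (C * omegaB n β q.2.1 q.2.2 ^ a * ‖G q.2.1 q.2.2‖ ^ 2) *
        ENNReal.ofReal (q.1 ^ b * Real.exp (-(omegaB n β q.2.1 q.2.2 / 128 * q.1))) := by
    have h1 : Measurable fun q : ℝ × En n × En n => omegaB n β q.2.1 q.2.2 :=
      (measurable_omegaB n β).comp measurable_snd
    have h2 : Measurable fun q : ℝ × En n × En n => G q.2.1 q.2.2 := hG.comp measurable_snd
    fun_prop
  calc _ ≤ ∫⁻ t in Ioo (0:ℝ) T, ∫⁻ (k : En n), ∫⁻ (η : En n),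
        ENNReal.ofReal (C * omegaB n β k η ^ a * ‖G k η‖ ^ 2) *
          ENNReal.ofReal (t ^ b * Real.exp (-(omegaB n β k η / 128 * t))) := by
        refine setLIntegral_mono' measurableSet_Ioo fun t ht => lintegral_mono fun k => ?_
        rw [← lintegral_sub_right_eq_self _ (t • k)]
        refine lintegral_mono fun η => ?_
        have hW := one_le_omegaB n β k η
        have ht0 : 0 < t := ht.1
        rw [← ENNReal.ofReal_mul (by positivity)]
        refine ENNReal.ofReal_le_ofReal ?_
        rw [sub_add_cancel, norm_mul, mul_pow, Complex.norm_real, Real.norm_eq_abs, sq_abs]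
        calc _ = t ^ b * ‖G k η‖ ^ 2 *
              (omegaB n β k (η - t • k) ^ a * eB n β t k (η - t • k) ^ 2) := by ring
          _ ≤ t ^ b * ‖G k η‖ ^ 2 * (C * omegaB n β k η ^ a *
              Real.exp (-(omegaB n β k η / 128 * t))) :=
            mul_le_mul_of_nonneg_left (hbound t ht k η) (by positivity)
          _ = _ := by ring
    _ = ∫⁻ (k : En n), ∫⁻ (η : En n), ∫⁻ t in Ioo (0:ℝ) T,
        ENNReal.ofReal (C * omegaB n β k η ^ a * ‖G k η‖ ^ 2) *
          ENNReal.ofReal (t ^ b * Real.exp (-(omegaB n β k η / 128 * t))) := by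
        rw [lintegral_lintegral_swap]
        · refine lintegral_congr fun k => ?_
          rw [lintegral_lintegral_swap]
          exact (hmeas.comp (by fun_prop :
            Measurable fun q : ℝ × En n => (q.1, k, q.2))).aemeasurable
        · exact (Measurable.lintegral_prod_right' (hmeas.comp (by fun_prop :
            Measurable fun q : (ℝ × En n) × En n => (q.1.1, q.1.2, q.2)))).aemeasurable
    _ ≤ ∫⁻ (k : En n), ∫⁻ (η : En n),
        ENNReal.ofReal (C * (128 ^ (b + 1) * Real.Gamma (b + 1))) *
          ENNReal.ofReal (omegaB n β k η ^ (a - (b + 1)) * ‖G k η‖ ^ 2) := by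
        refine lintegral_mono fun k => lintegral_mono fun η => ?_
        have hW : 0 < omegaB n β k η := one_pos.trans_le (one_le_omegaB n β k η)
        rw [lintegral_const_mul' _ _ ENNReal.ofReal_ne_top]
        refine (mul_le_mul_right (lintegral_rpow_mul_exp_neg_mul_le T hb0
          (by positivity : 0 < omegaB n β k η / 128)) _).trans_eq ?_
        rw [← ENNReal.ofReal_mul (by positivity), ← ENNReal.ofReal_mul (by positivity),
          Real.rpow_sub hW, one_div_div, Real.div_rpow (by norm_num) hW.le]
        congr 1
        ring
    _ = _ := by
        simp_rw [lintegral_const_mul' _ _ ENNReal.ofReal_ne_top]
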